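/- Let μ be a real number. The inequality M(a,b) < μ·(C(a,b)/6 + 5·A(a,b)/6) + (1-μ)·C(a,b)^{1/6}·A(a,b)^{5/6} holds for all a, b > 0 with a ≠ b if and only if μ ≥ 8/25. -/

import Mathlib

noncomputable def M (a b : ℝ) : ℝ := (a - b) / (2 * Real.arsinh ((a - b) / (a + b)))
noncomputable def A (a b : ℝ) : ℝ := (a + b) / 2
noncomputable def C (a b : ℝ) : ℝ := (a ^ 2 + b ^ 2) / (a + b)

lemma sqrt_div_lt_arsinh_sqrt {w : ℝ} (hw : 1 < w) :
    √(w ^ 6 - 1) / ((4 * w ^ 6 + 51 * w + 20) / 75) < Real.arsinh √(w ^ 6 - 1) := by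
  set F : ℝ → ℝ := fun t =>
    Real.arsinh √(t ^ 6 - 1) - √(t ^ 6 - 1) / ((4 * t ^ 6 + 51 * t + 20) / 75) with hF
  have hmono : StrictMonoOn F (Set.Ici 1) := by
    refine strictMonoOn_of_deriv_pos (convex_Ici 1) ?_ ?_
    · have hs : Continuous fun t : ℝ => √(t ^ 6 - 1) := by fun_prop
      refine (Real.continuous_arsinh.comp hs).continuousOn.sub
        (hs.continuousOn.div (by fun_prop) fun t ht => ?_)
      have ht : (1 : ℝ) ≤ t := ht
      positivity
    · intro t ht
      rw [interior_Ici] at ht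
      have ht : (1 : ℝ) < t := ht
      have hx : 0 < t ^ 6 - 1 := by linarith [one_lt_pow₀ ht (n := 6) (by norm_num)]
      set v := √(t ^ 6 - 1) with hv
      have hvpos : 0 < v := Real.sqrt_pos.2 hx
      have hvsq : v ^ 2 = t ^ 6 - 1 := Real.sq_sqrt hx.le
      have hpow : HasDerivAt (fun t : ℝ => t ^ 6) (6 * t ^ 5) t := by
        simpa using hasDerivAt_pow 6 t
      have hsq : HasDerivAt (fun t : ℝ => √(t ^ 6 - 1)) (6 * t ^ 5 / (2 * v)) t :=
        (hpow.sub_const 1).sqrt hx.ne'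
      have hg : HasDerivAt (fun t : ℝ => (4 * t ^ 6 + 51 * t + 20) / 75)
          ((4 * (6 * t ^ 5) + 51 * 1) / 75) t :=
        (((hpow.const_mul 4).add ((hasDerivAt_id t).const_mul 51)).add_const 20).div_const 75
      have hG : 0 < 4 * t ^ 6 + 51 * t + 20 := by positivity
      have hder : HasDerivAt F _ t :=
        hsq.arsinh.sub (hsq.div hg (by positivity))
      rw [hder.deriv]
      have hroot : √(1 + v ^ 2) = t ^ 3 := by
        rw [hvsq, show 1 + (t ^ 6 - 1) = (t ^ 3) ^ 2 by ring, Real.sqrt_sq (by positivity)]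
      rw [← hv, hroot, smul_eq_mul]
      have key : 0 < t ^ 2 * (4 * t ^ 6 + 51 * t + 20) ^ 2
          - 75 * t ^ 5 * (4 * t ^ 6 + 51 * t + 20) + 75 * (t ^ 6 - 1) * (8 * t ^ 5 + 17) := by
        obtain ⟨s, rfl⟩ : ∃ s, t = 1 + s := ⟨t - 1, by ring⟩
        have hs : 0 < s := by linarith
        ring_nf
        positivity
      have hcalc : (t ^ 3)⁻¹ * (6 * t ^ 5 / (2 * v)) -
          (6 * t ^ 5 / (2 * v) * ((4 * t ^ 6 + 51 * t + 20) / 75) -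
            v * ((4 * (6 * t ^ 5) + 51 * 1) / 75)) / ((4 * t ^ 6 + 51 * t + 20) / 75) ^ 2
          = 3 * (t ^ 2 * (4 * t ^ 6 + 51 * t + 20) ^ 2
          - 75 * t ^ 5 * (4 * t ^ 6 + 51 * t + 20) + 75 * v ^ 2 * (8 * t ^ 5 + 17)) /
            (v * (4 * t ^ 6 + 51 * t + 20) ^ 2) := by
        have : t ≠ 0 := by positivity
        field_simp
        ring
      rw [hcalc, hvsq]
      positivity
  have h := hmono (Set.mem_Ici.2 le_rfl) (Set.mem_Ici.2 hw.le) hw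
  simp only [hF] at h
  norm_num at h
  linarith

lemma arsinh_le_taylor {x : ℝ} (hx : 0 ≤ x) :
    Real.arsinh x ≤ x - x ^ 3 / 6 + 3 * x ^ 5 / 40 := by
  set F : ℝ → ℝ := fun t => t - t ^ 3 / 6 + 3 * t ^ 5 / 40 - Real.arsinh t with hF
  have hder (t : ℝ) :
      HasDerivAt F (1 - t ^ 2 / 2 + 3 * t ^ 4 / 8 - (√(1 + t ^ 2))⁻¹) t := by
    have h3 : HasDerivAt (fun t : ℝ => t ^ 3) (3 * t ^ 2) t := by
      simpa using hasDerivAt_pow 3 t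
    have h5 : HasDerivAt (fun t : ℝ => t ^ 5) (5 * t ^ 4) t := by
      simpa using hasDerivAt_pow 5 t
    refine HasDerivAt.congr_deriv (f := F) ((((hasDerivAt_id t).sub (h3.div_const 6)).add
      ((h5.const_mul 3).div_const 40)).sub (Real.hasDerivAt_arsinh t)) ?_
    ring
  have hmono : MonotoneOn F (Set.Ici 0) := by
    refine monotoneOn_of_deriv_nonneg (convex_Ici 0)
      (fun t _ => (hder t).continuousAt.continuousWithinAt)
      (fun t _ => (hder t).differentiableAt.differentiableWithinAt) fun t _ => ?_
    rw [(hder t).deriv, sub_nonneg]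
    have hp : 0 < 1 - t ^ 2 / 2 + 3 * t ^ 4 / 8 := by nlinarith [sq_nonneg (t ^ 2 - 2 / 3)]
    refine inv_le_of_inv_le₀ hp (Real.le_sqrt_of_sq_le ?_)
    rw [inv_pow]
    refine inv_le_of_inv_le₀ (by positivity) ?_
    rw [inv_le_iff_one_le_mul₀ (by positivity)]
    obtain ⟨y, hy⟩ : ∃ y, y = t ^ 2 := ⟨_, rfl⟩
    have hy0 : 0 ≤ y := hy ▸ sq_nonneg t
    have h4 : t ^ 4 = y ^ 2 := by rw [hy]; ring
    rw [h4, ← hy]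
    have : 0 ≤ y ^ 3 * (40 - 15 * y + 9 * y ^ 2) :=
      mul_nonneg (by positivity) (by nlinarith [sq_nonneg (y - 5 / 6)])
    nlinarith
  have h := hmono (Set.mem_Ici.2 le_rfl) (Set.mem_Ici.2 hx) hx
  simp only [hF] at h
  norm_num at h
  linarith

lemma one_add_rpow_sixth_le_taylor {x : ℝ} (hx : 0 ≤ x) (hx1 : x ≤ 1) :
    (1 + x) ^ ((1 : ℝ) / 6) ≤ 1 + x / 6 - 5 * x ^ 2 / 72 + 55 * x ^ 3 / 1296 := by
  have hnn : 0 ≤ 1 + x / 6 - 5 * x ^ 2 / 72 + 55 * x ^ 3 / 1296 := by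
    nlinarith [pow_nonneg hx 3]
  refine (Real.rpow_le_rpow (z := 1 / 6) (by positivity) ?_ (by norm_num)).trans_eq
    (?_ : ((1 + x / 6 - 5 * x ^ 2 / 72 + 55 * x ^ 3 / 1296) ^ (6 : ℕ)) ^ ((1 : ℝ) / 6) = _)
  · have h (n : ℕ) : x ^ (4 + n) ≤ x ^ 4 := pow_le_pow_of_le_one hx hx1 (by lia)
    have h6 : x ^ 6 ≤ x ^ 4 := h 2
    have h9 : x ^ 9 ≤ x ^ 4 := h 5
    have h12 : x ^ 12 ≤ x ^ 4 := h 8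
    have h14 : x ^ 14 ≤ x ^ 4 := h 10
    have h15 : x ^ 15 ≤ x ^ 4 := h 11
    have h17 : x ^ 17 ≤ x ^ 4 := h 13
    linarith [pow_nonneg hx 4, pow_nonneg hx 5, pow_nonneg hx 7, pow_nonneg hx 8,
      pow_nonneg hx 10, pow_nonneg hx 11, pow_nonneg hx 13, pow_nonneg hx 16, pow_nonneg hx 18]
  · rw [one_div]
    exact_mod_cast Real.pow_rpow_inv_natCast hnn (by norm_num : (6 : ℕ) ≠ 0)

lemma M_eq_A_mul {a b : ℝ} (ha : 0 < a) (hb : 0 < b) :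
    M a b = A a b * (|(a - b) / (a + b)| / Real.arsinh |(a - b) / (a + b)|) := by
  have heven (v : ℝ) : |v| / Real.arsinh |v| = v / Real.arsinh v := by
    rcases abs_choice v with h | h <;> rw [h]
    rw [Real.arsinh_neg, neg_div_neg_eq]
  rw [heven, M, A]
  have : a + b ≠ 0 := by positivity
  field_simp

lemma C_eq_A_mul {a b : ℝ} (ha : 0 < a) (hb : 0 < b) :
    C a b = A a b * (1 + |(a - b) / (a + b)| ^ 2) := by
  rw [sq_abs, C, A]
  have : a + b ≠ 0 := by positivity
  field_simp
  ring

lemma C_rpow_mul_A_rpow {a b : ℝ} (ha : 0 < a) (hb : 0 < b) :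
    C a b ^ ((1 : ℝ) / 6) * A a b ^ ((5 : ℝ) / 6) =
      A a b * (1 + |(a - b) / (a + b)| ^ 2) ^ ((1 : ℝ) / 6) := by
  have hA : 0 < A a b := by unfold A; positivity
  rw [C_eq_A_mul ha hb, Real.mul_rpow hA.le (by positivity), mul_right_comm,
    ← Real.rpow_add hA]
  norm_num

lemma M_lt_iff {a b : ℝ} (ha : 0 < a) (hb : 0 < b) (μ : ℝ) :
    M a b < μ * (C a b / 6 + 5 * A a b / 6) +
        (1 - μ) * (C a b ^ ((1 : ℝ) / 6) * A a b ^ ((5 : ℝ) / 6)) ↔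
      |(a - b) / (a + b)| / Real.arsinh |(a - b) / (a + b)| <
        μ * (1 + |(a - b) / (a + b)| ^ 2 / 6) +
          (1 - μ) * (1 + |(a - b) / (a + b)| ^ 2) ^ ((1 : ℝ) / 6) := by
  have hA : 0 < A a b := by unfold A; positivity
  rw [C_rpow_mul_A_rpow ha hb, M_eq_A_mul ha hb, C_eq_A_mul ha hb]
  rw [← mul_lt_mul_iff_right₀ hA (b := |(a - b) / (a + b)| / _)]
  ring_nf

lemma div_arsinh_lt {v μ : ℝ} (hv : 0 < v) (hμ : 8 / 25 ≤ μ) :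
    v / Real.arsinh v < μ * (1 + v ^ 2 / 6) + (1 - μ) * (1 + v ^ 2) ^ ((1 : ℝ) / 6) := by
  set w : ℝ := (1 + v ^ 2) ^ ((1 : ℝ) / 6) with hw
  have hw1 : 1 < w := Real.one_lt_rpow (by nlinarith [sq_pos_of_pos hv]) (by norm_num)
  have hw6 : w ^ 6 = 1 + v ^ 2 := by
    rw [hw, one_div]
    exact_mod_cast Real.rpow_inv_natCast_pow (by positivity : 0 ≤ 1 + v ^ 2)
      (by norm_num : (6 : ℕ) ≠ 0)
  have hsqrt : √(w ^ 6 - 1) = v := by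
    rw [hw6, add_sub_cancel_left, Real.sqrt_sq hv.le]
  have h := sqrt_div_lt_arsinh_sqrt hw1
  have hG : 0 < (4 * w ^ 6 + 51 * w + 20) / 75 := by positivity
  rw [hsqrt, div_lt_comm₀ hG (Real.arsinh_pos_iff.2 hv), hw6] at h
  have hbern : 1 + 6 * (w - 1) ≤ w ^ 6 := by
    simpa using one_add_mul_le_pow (by linarith : (-2 : ℝ) ≤ w - 1) 6
  rw [hw6] at hbern
  nlinarith [mul_nonneg (sub_nonneg.2 hμ) (by linarith : 0 ≤ 1 + v ^ 2 / 6 - w)]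

lemma exists_le_div_arsinh {μ : ℝ} (hμ : μ < 8 / 25) :
    ∃ v : ℝ, 0 < v ∧ v < 1 ∧
      μ * (1 + v ^ 2 / 6) + (1 - μ) * (1 + v ^ 2) ^ ((1 : ℝ) / 6) ≤ v / Real.arsinh v := by
  obtain ⟨δ, hδ⟩ : ∃ δ, δ = 8 / 25 - μ := ⟨_, rfl⟩
  have hδ0 : 0 < δ := by linarith
  obtain ⟨x, hx⟩ : ∃ x, x = δ / (4 * (1 + δ) ^ 2) := ⟨_, rfl⟩
  have hx0 : 0 < x := hx ▸ by positivity
  have hxδ : x * (1 + δ) ≤ δ / 4 := by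
    rw [hx, div_mul_eq_mul_div, div_le_div_iff₀ (by positivity) (by positivity)]
    nlinarith [mul_pos hδ0 hδ0, pow_pos hδ0 3]
  have hxδ1 : x * (1 + δ) ≤ 1 / 4 := by
    rw [hx, div_mul_eq_mul_div, div_le_div_iff₀ (by positivity) (by positivity)]
    nlinarith [mul_pos hδ0 hδ0]
  have hx1 : x ≤ 1 / 4 := by nlinarith [mul_pos hx0 hδ0]
  obtain ⟨v, hv⟩ : ∃ v, v = √x := ⟨_, rfl⟩
  have hv0 : 0 < v := hv ▸ Real.sqrt_pos.2 hx0
  have hv2 : v ^ 2 = x := by rw [hv, Real.sq_sqrt hx0.le]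
  refine ⟨v, hv0, by nlinarith, ?_⟩
  rw [le_div_iff₀ (Real.arsinh_pos_iff.2 hv0), hv2]
  have hroot := one_add_rpow_sixth_le_taylor hx0.le (by linarith)
  have hasinh := arsinh_le_taylor hv0.le
  have hasinh' : v - v ^ 3 / 6 + 3 * v ^ 5 / 40 = v * (1 - x / 6 + 3 * x ^ 2 / 40) := by
    rw [← hv2]; ring
  rw [hasinh'] at hasinh
  have hmean : μ * (1 + x / 6) + (1 - μ) * (1 + x) ^ ((1 : ℝ) / 6) ≤
      1 + x / 6 - (17 / 25 + δ) * (5 * x ^ 2 / 72 - 55 * x ^ 3 / 1296) := by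
    have := mul_le_mul_of_nonneg_left hroot (by linarith : 0 ≤ 1 - μ)
    rw [hδ]
    linarith
  refine (mul_le_mul hmean hasinh (Real.arsinh_nonneg_iff.2 hv0.le) ?_).trans ?_
  · nlinarith [mul_le_mul_of_nonneg_left hxδ1 hx0.le, mul_pos hx0 hx0, pow_pos hx0 3,
      mul_pos hδ0 (pow_pos hx0 3)]
  · have hx2 := sq_nonneg x
    have hx3 := pow_pos hx0 3
    have hδx4 : 0 ≤ δ * x ^ 4 := by positivity
    have hx4 : 0 ≤ x ^ 4 := by positivity
    have h3 : x ^ 2 * (x * (1 + δ)) ≤ x ^ 2 * (δ / 4) := mul_le_mul_of_nonneg_left hxδ hx2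
    have h5 : x ^ 4 * (x * (1 + δ)) ≤ x ^ 4 * (1 / 4) := mul_le_mul_of_nonneg_left hxδ1 hx4
    have hδx2 : 0 ≤ δ * x ^ 2 := by positivity
    have hx5 : 0 ≤ x ^ 5 := by positivity
    have hpoly : (1 + x / 6 - (17 / 25 + δ) * (5 * x ^ 2 / 72 - 55 * x ^ 3 / 1296)) *
        (1 - x / 6 + 3 * x ^ 2 / 40) ≤ 1 := by
      linarith
    nlinarith

theorem stmt_7 (μ : ℝ) :
    (∀ a b : ℝ, 0 < a → 0 < b → a ≠ b →
      M a b < μ * (C a b / 6 + 5 * A a b / 6) +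
        (1 - μ) * (C a b ^ ((1 : ℝ)/6) * A a b ^ ((5 : ℝ)/6))) ↔
    μ ≥ 8/25 := by
  constructor
  · intro h
    by_contra! hμ
    obtain ⟨v, hv0, hv1, hle⟩ := exists_le_div_arsinh hμ
    have hlt := (M_lt_iff (by linarith) (by linarith) μ).1
      (h (1 + v) (1 - v) (by linarith) (by linarith) (by linarith))
    rw [show (1 + v - (1 - v)) / (1 + v + (1 - v)) = v by ring, abs_of_pos hv0] at hlt
    exact hlt.not_ge hle
  · intro hμ a b ha hb hab
    rw [M_lt_iff ha hb]
    exact div_arsinh_lt (abs_pos.2 (div_ne_zero (sub_ne_zero.2 hab) (by positivity))) hμ
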